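/- arXiv:2402.09174 — 8 statements merged into one kernel-verified Lean document; each statement's English description precedes it below -/
import Mathlib

section
/- Let K : ℕ+ → (0,∞) → ℝ be a family of functions with K n x > 0 for all n and x, which is RR₂ in (n,x), i.e. for all n₁ ≤ n₂ in ℕ+ and x₁ ≤ x₂ in (0,∞), K n₁ x₁ * K n₂ x₂ ≤ K n₂ x₁ * K n₁ x₂. Let f : ℕ+ → (0,∞) → ℝ satisfy: (i) for each x and all n₁ ≤ n₂, f n₁ x ≥ 0 implies f n₂ x ≥ 0 (f changes sign at most once in n, from negative to positive); (ii) for each n, x ↦ f n x is decreasing on (0,∞); (iii) for each x the series w(x) = ∑_{n=1}^∞ f n x * K n x converges absolutely. Then w changes sign at most once, from positive to negative: for all x ≤ x₀ in (0,∞), if w(x₀) = 0 then w(x) ≥ 0. -/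
/-- Proposition 3.1: variation diminishing property for an RR₂ kernel with
sign change of `f` from negative to positive in `n`, and `f` decreasing in `x`. -/
theorem prop_3_1
    (K f : ℕ+ → ℝ → ℝ)
    (hKpos : ∀ (n : ℕ+) (x : ℝ), 0 < x → 0 < K n x)
    (hRR2 : ∀ (n₁ n₂ : ℕ+), n₁ ≤ n₂ → ∀ (x₁ x₂ : ℝ), 0 < x₁ → x₁ ≤ x₂ →
      K n₁ x₁ * K n₂ x₂ ≤ K n₂ x₁ * K n₁ x₂)
    (hsign : ∀ (x : ℝ), 0 < x → ∀ (n₁ n₂ : ℕ+), n₁ ≤ n₂ → 0 ≤ f n₁ x → 0 ≤ f n₂ x)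
    (hdec : ∀ (n : ℕ+) (x₁ x₂ : ℝ), 0 < x₁ → x₁ ≤ x₂ → f n x₂ ≤ f n x₁)
    (hsum : ∀ (x : ℝ), 0 < x → Summable (fun n : ℕ+ => |f n x * K n x|))
    (x x₀ : ℝ) (hx : 0 < x) (hxx₀ : x ≤ x₀)
    (h0 : ∑' n : ℕ+, f n x₀ * K n x₀ = 0) :
    0 ≤ ∑' n : ℕ+, f n x * K n x := by
  have hx₀ : 0 < x₀ := lt_of_lt_of_le hx hxx₀
  have S : Summable (fun n : ℕ+ => f n x * K n x) := (hsum x hx).of_abs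
  have S₀ : Summable (fun n : ℕ+ => f n x₀ * K n x₀) := (hsum x₀ hx₀).of_abs
  have hex : ∃ n : ℕ+, 0 ≤ f n x₀ := by
    by_contra hne
    have hneg : ∀ n : ℕ+, f n x₀ < 0 := fun n => by
      by_contra hn
      exact hne ⟨n, not_lt.mp hn⟩
    have hp : 0 < ∑' n : ℕ+, -(f n x₀ * K n x₀) :=
      S₀.neg.tsum_pos
        (fun n => by nlinarith [mul_pos (neg_pos.mpr (hneg n)) (hKpos n x₀ hx₀)]) 1
        (by nlinarith [mul_pos (neg_pos.mpr (hneg 1)) (hKpos 1 x₀ hx₀)])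
    rw [tsum_neg, h0] at hp
    simp at hp
  classical
  have hm := PNat.find_spec hex
  have hmin : ∀ n : ℕ+, n < PNat.find hex → f n x₀ < 0 := fun n hn =>
    not_le.mp (PNat.find_min hex hn)
  generalize PNat.find hex = m at hm hmin
  have hKm := hKpos m x₀ hx₀
  have key : ∀ n : ℕ+, K m x / K m x₀ * (f n x₀ * K n x₀) ≤ f n x * K n x := by
    intro n
    have h1 : f n x₀ * K n x ≤ f n x * K n x :=
      mul_le_mul_of_nonneg_right (hdec n x x₀ hx hxx₀) (hKpos n x hx).le
    refine le_trans ?_ h1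
    rw [div_mul_eq_mul_div, div_le_iff₀ hKm]
    rcases le_or_gt m n with h | h
    · nlinarith [mul_le_mul_of_nonneg_left (hRR2 m n h x x₀ hx hxx₀) (hsign x₀ hx₀ m n h hm)]
    · nlinarith [mul_le_mul_of_nonpos_left (hRR2 n m h.le x x₀ hx hxx₀) (hmin n h).le]
  have := (S₀.mul_left (K m x / K m x₀)).tsum_le_tsum key S
  rwa [tsum_mul_left, h0, mul_zero] at this
end

section
/- Let K : ℕ+ → (0,∞) → ℝ be a family of functions with K n x > 0 for all n and x, which is RR₂ in (n,x), i.e. for all n₁ ≤ n₂ in ℕ+ and x₁ ≤ x₂ in (0,∞), K n₁ x₁ * K n₂ x₂ ≤ K n₂ x₁ * K n₁ x₂. Let f : ℕ+ → (0,∞) → ℝ satisfy: (i) for each x and all n₁ ≤ n₂, f n₁ x ≤ 0 implies f n₂ x ≤ 0 (f changes sign at most once in n, from positive to negative); (ii) for each n, x ↦ f n x is increasing on (0,∞); (iii) for each x the series w(x) = ∑_{n=1}^∞ f n x * K n x converges absolutely. Then w changes sign at most once, from negative to positive: for all x ≤ x₀ in (0,∞), if w(x₀) = 0 then w(x) ≤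 0. -/
/-- Proposition 3.2: variation diminishing property for an RR₂ kernel with
sign change of `f` from positive to negative in `n`, and `f` increasing in `x`. -/
theorem prop_3_2
    (K f : ℕ+ → ℝ → ℝ)
    (hKpos : ∀ (n : ℕ+) (x : ℝ), 0 < x → 0 < K n x)
    (hRR2 : ∀ (n₁ n₂ : ℕ+), n₁ ≤ n₂ → ∀ (x₁ x₂ : ℝ), 0 < x₁ → x₁ ≤ x₂ →
      K n₁ x₁ * K n₂ x₂ ≤ K n₂ x₁ * K n₁ x₂)
    (hsign : ∀ (x : ℝ), 0 < x → ∀ (n₁ n₂ : ℕ+), n₁ ≤ n₂ → f n₁ x ≤ 0 → f n₂ x ≤ 0)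
    (hinc : ∀ (n : ℕ+) (x₁ x₂ : ℝ), 0 < x₁ → x₁ ≤ x₂ → f n x₁ ≤ f n x₂)
    (hsum : ∀ (x : ℝ), 0 < x → Summable (fun n : ℕ+ => |f n x * K n x|))
    (x x₀ : ℝ) (hx : 0 < x) (hxx₀ : x ≤ x₀)
    (h0 : ∑' n : ℕ+, f n x₀ * K n x₀ = 0) :
    ∑' n : ℕ+, f n x * K n x ≤ 0 := by
  have hx₀ : 0 < x₀ := lt_of_lt_of_le hx hxx₀
  have hs : Summable (fun n : ℕ+ => f n x * K n x) := (hsum x hx).of_abs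
  have hs₀ : Summable (fun n : ℕ+ => f n x₀ * K n x₀) := (hsum x₀ hx₀).of_abs
  by_cases hne : ∃ n : ℕ+, f n x₀ ≤ 0
  · classical
    obtain ⟨m, hm, hmin⟩ : ∃ m : ℕ+, f m x₀ ≤ 0 ∧ ∀ n, n < m → 0 < f n x₀ :=
      ⟨PNat.find hne, PNat.find_spec hne, fun n hn => not_le.mp (PNat.find_min hne hn)⟩
    have hKm := hKpos m x₀ hx₀
    have key : ∀ n : ℕ+, f n x * K n x ≤ (K m x / K m x₀) * (f n x₀ * K n x₀) := by
      intro n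
      have h1 : f n x * K n x ≤ f n x₀ * K n x :=
        mul_le_mul_of_nonneg_right (hinc n x x₀ hx hxx₀) (hKpos n x hx).le
      refine h1.trans ?_
      rw [div_mul_eq_mul_div, le_div_iff₀ hKm]
      rcases lt_or_ge n m with h | h
      · have h2 := hRR2 n m h.le x x₀ hx hxx₀
        have h3 := mul_le_mul_of_nonneg_left h2 (hmin n h).le
        linarith
      · have h2 := hRR2 m n h x x₀ hx hxx₀
        have h3 := mul_le_mul_of_nonpos_left h2 (hsign x₀ hx₀ m n h hm)
        linarith
    calc ∑' n : ℕ+, f n x * K n x ≤ ∑' n : ℕ+, (K m x / K m x₀) * (f n x₀ * K n x₀) :=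
          hs.tsum_le_tsum key (hs₀.mul_left _)
      _ = 0 := by rw [tsum_mul_left, h0, mul_zero]
  · push Not at hne
    have hp : ∀ n : ℕ+, 0 < f n x₀ * K n x₀ := fun n => mul_pos (hne n) (hKpos n x₀ hx₀)
    have := hs₀.tsum_pos (fun n => (hp n).le) 1 (hp 1)
    linarith
end

section
/- Let K : ℕ+ → (0,∞) → ℝ be a family of functions with K n x > 0 for all n and x, which is TP₂ in (n,x), i.e. for all n₁ ≤ n₂ in ℕ+ and x₁ ≤ x₂ in (0,∞), K n₁ x₁ * K n₂ x₂ ≥ K n₂ x₁ * K n₁ x₂. Let f : ℕ+ → (0,∞) → ℝ satisfy: (i) for each x and all n₁ ≤ n₂, f n₁ x ≤ 0 implies f n₂ x ≤ 0 (f changes sign at most once in n, from positive to negative); (ii) for each n, x ↦ f n x is decreasing on (0,∞); (iii) for each x the series w(x) = ∑_{n=1}^∞ f n x * K n x converges absolutely. Then w changes sign at most once, from positive to negative: for all x ≤ x₀ in (0,∞), if w(x₀) = 0 then w(x) ≥ 0. -/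
/-- Proposition 3.3: variation diminishing property for a TP₂ kernel with
sign change of `f` from positive to negative in `n`, and `f` decreasing in `x`. -/
theorem prop_3_3
    (K f : ℕ+ → ℝ → ℝ)
    (hKpos : ∀ (n : ℕ+) (x : ℝ), 0 < x → 0 < K n x)
    (hTP2 : ∀ (n₁ n₂ : ℕ+), n₁ ≤ n₂ → ∀ (x₁ x₂ : ℝ), 0 < x₁ → x₁ ≤ x₂ →
      K n₁ x₁ * K n₂ x₂ ≥ K n₂ x₁ * K n₁ x₂)
    (hsign : ∀ (x : ℝ), 0 < x → ∀ (n₁ n₂ : ℕ+), n₁ ≤ n₂ → f n₁ x ≤ 0 → f n₂ x ≤ 0)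
    (hdec : ∀ (n : ℕ+) (x₁ x₂ : ℝ), 0 < x₁ → x₁ ≤ x₂ → f n x₂ ≤ f n x₁)
    (hsum : ∀ (x : ℝ), 0 < x → Summable (fun n : ℕ+ => |f n x * K n x|))
    (x x₀ : ℝ) (hx : 0 < x) (hxx₀ : x ≤ x₀)
    (h0 : ∑' n : ℕ+, f n x₀ * K n x₀ = 0) :
    0 ≤ ∑' n : ℕ+, f n x * K n x := by
  have hx0 : 0 < x₀ := hx.trans_le hxx₀
  by_cases hex : ∃ n : ℕ+, f n x₀ ≤ 0
  · obtain ⟨m, hm, hmin⟩ : ∃ m : ℕ+, f m x₀ ≤ 0 ∧ ∀ n, n < m → ¬ f n x₀ ≤ 0 := by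
      classical
      exact ⟨PNat.find hex, PNat.find_spec hex, fun n hn => PNat.find_min hex hn⟩
    have hKm := hKpos m x₀ hx0
    have key : ∀ n : ℕ+, (K m x / K m x₀) * (f n x₀ * K n x₀) ≤ f n x * K n x := by
      intro n
      have h1 : f n x₀ * K n x ≤ f n x * K n x :=
        mul_le_mul_of_nonneg_right (hdec n x x₀ hx hxx₀) (hKpos n x hx).le
      refine le_trans ?_ h1
      rw [div_mul_eq_mul_div, div_le_iff₀ hKm]
      rcases lt_or_ge n m with h | h
      · have h2 := hTP2 n m h.le x x₀ hx hxx₀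
        have h3 := lt_of_not_ge (hmin n h)
        have := mul_le_mul_of_nonneg_left h2 h3.le
        linarith
      · have h2 := hTP2 m n h x x₀ hx hxx₀
        have h3 := hsign x₀ hx0 m n h hm
        have := mul_le_mul_of_nonpos_left h2 h3
        linarith
    have hs := (hsum x₀ hx0).of_abs.mul_left (K m x / K m x₀)
    have := hs.tsum_le_tsum key (hsum x hx).of_abs
    rwa [tsum_mul_left, h0, mul_zero] at this
  · push Not at hex
    exact tsum_nonneg fun n => mul_nonneg
      ((hex n).le.trans (hdec n x x₀ hx hxx₀)) (hKpos n x hx).le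
end

section
/- Let K : ℕ+ → (0,∞) → ℝ be a family of functions with K n x > 0 for all n and x, which is TP₂ in (n,x), i.e. for all n₁ ≤ n₂ in ℕ+ and x₁ ≤ x₂ in (0,∞), K n₁ x₁ * K n₂ x₂ ≥ K n₂ x₁ * K n₁ x₂. Let f : ℕ+ → (0,∞) → ℝ satisfy: (i) for each x and all n₁ ≤ n₂, f n₁ x ≥ 0 implies f n₂ x ≥ 0 (f changes sign at most once in n, from negative to positive); (ii) for each n, x ↦ f n x is increasing on (0,∞); (iii) for each x the series w(x) = ∑_{n=1}^∞ f n x * K n x converges absolutely. Then w changes sign at most once, from negative to positive: for all x ≤ x₀ in (0,∞), if w(x₀) = 0 then w(x) ≤ 0. -/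
/-- Proposition 3.4: variation diminishing property for a TP₂ kernel with
sign change of `f` from negative to positive in `n`, and `f` increasing in `x`. -/
theorem prop_3_4
    (K f : ℕ+ → ℝ → ℝ)
    (hKpos : ∀ (n : ℕ+) (x : ℝ), 0 < x → 0 < K n x)
    (hTP2 : ∀ (n₁ n₂ : ℕ+), n₁ ≤ n₂ → ∀ (x₁ x₂ : ℝ), 0 < x₁ → x₁ ≤ x₂ →
      K n₁ x₁ * K n₂ x₂ ≥ K n₂ x₁ * K n₁ x₂)
    (hsign : ∀ (x : ℝ), 0 < x → ∀ (n₁ n₂ : ℕ+), n₁ ≤ n₂ → 0 ≤ f n₁ x → 0 ≤ f n₂ x)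
    (hinc : ∀ (n : ℕ+) (x₁ x₂ : ℝ), 0 < x₁ → x₁ ≤ x₂ → f n x₁ ≤ f n x₂)
    (hsum : ∀ (x : ℝ), 0 < x → Summable (fun n : ℕ+ => |f n x * K n x|))
    (x x₀ : ℝ) (hx : 0 < x) (hxx₀ : x ≤ x₀)
    (h0 : ∑' n : ℕ+, f n x₀ * K n x₀ = 0) :
    ∑' n : ℕ+, f n x * K n x ≤ 0 := by
  classical
  have hx0 : 0 < x₀ := lt_of_lt_of_le hx hxx₀
  by_cases hex : ∃ n : ℕ+, 0 ≤ f n x₀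
  · let m := PNat.find hex
    have hm : 0 ≤ f m x₀ := PNat.find_spec hex
    have hlt : ∀ n, n < m → f n x₀ < 0 := fun n hn => not_le.mp (PNat.find_min hex hn)
    generalize m = m at hm hlt
    have hKm := hKpos m x₀ hx0
    have key : ∀ n : ℕ+, f n x * K n x ≤ K m x / K m x₀ * (f n x₀ * K n x₀) := by
      intro n
      have h1 : f n x * K n x ≤ f n x₀ * K n x :=
        mul_le_mul_of_nonneg_right (hinc n x x₀ hx hxx₀) (hKpos n x hx).le
      refine h1.trans ?_
      rw [div_mul_eq_mul_div, le_div_iff₀ hKm]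
      rcases lt_or_ge n m with h | h
      · have := hTP2 n m h.le x x₀ hx hxx₀
        nlinarith [mul_le_mul_of_nonpos_left this (hlt n h).le]
      · have := hTP2 m n h x x₀ hx hxx₀
        nlinarith [mul_le_mul_of_nonneg_left this (hsign x₀ hx0 m n h hm)]
    have hs : Summable (fun n : ℕ+ => f n x * K n x) := (hsum x hx).of_abs
    have hs0 : Summable (fun n : ℕ+ => f n x₀ * K n x₀) := (hsum x₀ hx0).of_abs
    have := hs.tsum_le_tsum key (hs0.mul_left _)
    rwa [tsum_mul_left, h0, mul_zero] at this
  · push Not at hex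
    exact tsum_nonpos fun n => mul_nonpos_of_nonpos_of_nonneg
      ((hinc n x x₀ hx hxx₀).trans (hex n).le) (hKpos n x hx).le
end

section
/- Let f_{1:n}, g_{1:n} : (0,∞) → (0,∞) (n ∈ ℕ+) be families of positive functions (the densities of minimum order statistics X_{1:n} and Y_{1:n}), and let p : ℕ+ → ℝ satisfy p(n) ≥ 0 for all n and ∑_{n=1}^∞ p(n) = 1 (a probability mass function). Assume: (i) for each n, the map x ↦ g_{1:n}(x)/f_{1:n}(x) is decreasing on (0,∞) (i.e. X_{1:n} ≥_lr Y_{1:n} for every n); (ii) for each x, the map n ↦ g_{1:n}(x)/f_{1:n}(x) is increasing on ℕ+; (iii) for all n₁ ≤ n₂ in ℕ+, the map x ↦ f_{1:n₁}(x)/f_{1:n₂}(x) is increasing on (0,∞) (i.e. X_{1:n₁} ≥_lr X_{1:n₂} whenever n₁ ≤ n₂); (iv) for each x, the series ∑_{n=1}^∞ p(n) f_{1:n}(x) and ∑_{n=1}^∞ p(n) g_{1:n}(x) converge. Then the map x ↦ (∑_{n=1}^∞ p(n) g_{1:n}(x)) / (∑_{n=1}^∞ p(n) f_{1:n}(x))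 is decreasing on (0,∞), i.e. X_{1:N} ≥_lr Y_{1:N} where N has pmf p. -/
theorem aux_prod (a b c d : ℕ+ → ℝ) (ha : ∀ n, 0 ≤ a n) (hb : ∀ n, 0 ≤ b n)
    (hc : ∀ n, 0 ≤ c n) (hd : ∀ n, 0 ≤ d n)
    (sa : Summable a) (sb : Summable b) (sc : Summable c) (sd : Summable d)
    (h : ∀ n m, c n * d m + c m * d n ≤ a n * b m + a m * b n) :
    (∑' n, c n) * (∑' n, d n) ≤ (∑' n, a n) * (∑' n, b n) := by
  have key : ∀ u v : ℕ+ → ℝ, (∀ n, 0 ≤ u n) → (∀ n, 0 ≤ v n) → Summable u → Summable v →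
      HasSum (fun z : ℕ+ × ℕ+ => u z.1 * v z.2 + u z.2 * v z.1)
        ((∑' n, u n) * (∑' n, v n) + (∑' n, u n) * (∑' n, v n)) := by
    intro u v hu hv su sv
    have h1 : HasSum (fun z : ℕ+ × ℕ+ => u z.1 * v z.2) ((∑' n, u n) * (∑' n, v n)) :=
      su.hasSum.mul sv.hasSum (su.mul_of_nonneg sv hu hv)
    have h2 : HasSum (fun z : ℕ+ × ℕ+ => u z.2 * v z.1) ((∑' n, u n) * (∑' n, v n)) :=
      (Equiv.prodComm ℕ+ ℕ+).hasSum_iff.mpr h1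
    exact h1.add h2
  have := hasSum_le (fun z : ℕ+ × ℕ+ => h z.1 z.2) (key c d hc hd sc sd) (key a b ha hb sa sb)
  linarith

/-- Theorem 3.5: likelihood ratio ordering of random minima. -/
theorem thm_3_5
    (f1n g1n : ℕ+ → ℝ → ℝ)
    (hfpos : ∀ (n : ℕ+) (x : ℝ), 0 < x → 0 < f1n n x)
    (hgpos : ∀ (n : ℕ+) (x : ℝ), 0 < x → 0 < g1n n x)
    (p : ℕ+ → ℝ) (hp : ∀ n, 0 ≤ p n) (hp1 : HasSum p 1)
    -- (i) X_{1:n} ≥_lr Y_{1:n} for every n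
    (hlr : ∀ n : ℕ+, AntitoneOn (fun x => g1n n x / f1n n x) (Set.Ioi 0))
    -- (ii) the ratio g_{1:n}/f_{1:n} is increasing in n
    (hmono : ∀ x : ℝ, 0 < x → Monotone (fun n : ℕ+ => g1n n x / f1n n x))
    -- (iii) X_{1:n₁} ≥_lr X_{1:n₂} whenever n₁ ≤ n₂
    (hRR2 : ∀ n₁ n₂ : ℕ+, n₁ ≤ n₂ →
      MonotoneOn (fun x => f1n n₁ x / f1n n₂ x) (Set.Ioi 0))
    -- (iv) summability
    (hsumf : ∀ x : ℝ, 0 < x → Summable (fun n : ℕ+ => p n * f1n n x))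
    (hsumg : ∀ x : ℝ, 0 < x → Summable (fun n : ℕ+ => p n * g1n n x)) :
    AntitoneOn (fun x => (∑' n : ℕ+, p n * g1n n x) / (∑' n : ℕ+, p n * f1n n x))
      (Set.Ioi 0) := by
  intro x hx y hy hxy
  have hx0 : 0 < x := hx
  have hy0 : 0 < y := hy
  have hFpos : ∀ z : ℝ, 0 < z → 0 < ∑' n : ℕ+, p n * f1n n z := by
    intro z hz
    have hne : ∃ n, 0 < p n := by
      by_contra hcon
      push Not at hcon
      have h0 : p = fun _ => 0 := funext fun n => le_antisymm (hcon n) (hp n)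
      rw [h0] at hp1
      exact zero_ne_one (hasSum_zero.unique hp1)
    obtain ⟨n, hn⟩ := hne
    exact (hsumf z hz).tsum_pos (fun i => mul_nonneg (hp i) (hfpos i z hz).le) n
      (mul_pos hn (hfpos n z hz))
  show (∑' n : ℕ+, p n * g1n n y) / (∑' n : ℕ+, p n * f1n n y) ≤
    (∑' n : ℕ+, p n * g1n n x) / (∑' n : ℕ+, p n * f1n n x)
  rw [div_le_div_iff₀ (hFpos y hy0) (hFpos x hx0)]
  have main : ∀ n m : ℕ+, n ≤ m → g1n n y * f1n m x + g1n m y * f1n n x ≤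
      g1n n x * f1n m y + g1n m x * f1n n y := by
    intro n m hnm
    have a1 := hfpos n x hx0
    have a2 := hfpos m x hx0
    have a3 := hfpos n y hy0
    have a4 := hfpos m y hy0
    have h1 : g1n n y / f1n n y ≤ g1n n x / f1n n x := hlr n hx hy hxy
    have h2 : g1n m y / f1n m y ≤ g1n m x / f1n m x := hlr m hx hy hxy
    have h3 : g1n n x / f1n n x ≤ g1n m x / f1n m x := hmono x hx0 hnm
    have h4 : f1n n x / f1n m x ≤ f1n n y / f1n m y := hRR2 n m hnm hx hy hxy
    rw [div_le_div_iff₀ a2 a4] at h4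
    rw [div_le_iff₀ a3] at h1
    rw [div_le_iff₀ a4] at h2
    have e1 : g1n n x = g1n n x / f1n n x * f1n n x := by field_simp
    have e2 : g1n m x = g1n m x / f1n m x * f1n m x := by field_simp
    generalize g1n n x / f1n n x = r at *
    generalize g1n m x / f1n m x = s at *
    rw [e1, e2]
    have k1 := mul_le_mul_of_nonneg_right h1 a2.le
    have k2 := mul_le_mul_of_nonneg_right h2 a1.le
    have k3 := mul_nonneg (sub_nonneg.2 h3) (sub_nonneg.2 h4)
    linarith
  have main' : ∀ n m : ℕ+, g1n n y * f1n m x + g1n m y * f1n n x ≤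
      g1n n x * f1n m y + g1n m x * f1n n y := by
    intro n m
    rcases le_total n m with h | h
    · exact main n m h
    · linarith [main m n h]
  refine aux_prod _ _ _ _ (fun n => mul_nonneg (hp n) (hgpos n x hx0).le)
    (fun n => mul_nonneg (hp n) (hfpos n y hy0).le)
    (fun n => mul_nonneg (hp n) (hgpos n y hy0).le)
    (fun n => mul_nonneg (hp n) (hfpos n x hx0).le)
    (hsumg x hx0) (hsumf y hy0) (hsumg y hy0) (hsumf x hx0) ?_
  intro n m
  have := mul_le_mul_of_nonneg_left (main' n m) (mul_nonneg (hp n) (hp m))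
  linarith
end

section
/- Let f_{1:n}, g_{1:n} : (0,∞) → (0,∞) (n ∈ ℕ+) be families of positive functions (the densities of minimum order statistics X_{1:n} and Y_{1:n}), and let p : ℕ+ → ℝ satisfy p(n) ≥ 0 for all n and ∑_{n=1}^∞ p(n) = 1 (a probability mass function). Assume: (i) for each n, the map x ↦ g_{1:n}(x)/f_{1:n}(x) is increasing on (0,∞) (i.e. X_{1:n} ≤_lr Y_{1:n} for every n); (ii) for each x, the map n ↦ g_{1:n}(x)/f_{1:n}(x) is decreasing on ℕ+; (iii) for all n₁ ≤ n₂ in ℕ+, the map x ↦ f_{1:n₁}(x)/f_{1:n₂}(x) is increasing on (0,∞) (i.e. X_{1:n₁} ≥_lr X_{1:n₂} whenever n₁ ≤ n₂); (iv) for each x, the series ∑_{n=1}^∞ p(n) f_{1:n}(x) and ∑_{n=1}^∞ p(n) g_{1:n}(x) converge. Then the map x ↦ (∑_{n=1}^∞ p(n) g_{1:n}(x)) / (∑_{n=1}^∞ p(n) f_{1:n}(x)) is increasing on (0,∞), i.e. X_{1:N} ≤_lr Y_{1:N} where N has pmf p. -/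
/-- Theorem 3.6: likelihood ratio ordering of random minima. -/
theorem thm_3_6
    (f1n g1n : ℕ+ → ℝ → ℝ)
    (hfpos : ∀ (n : ℕ+) (x : ℝ), 0 < x → 0 < f1n n x)
    (hgpos : ∀ (n : ℕ+) (x : ℝ), 0 < x → 0 < g1n n x)
    (p : ℕ+ → ℝ) (hp : ∀ n, 0 ≤ p n) (hp1 : HasSum p 1)
    -- (i) X_{1:n} ≤_lr Y_{1:n} for every n
    (hlr : ∀ n : ℕ+, MonotoneOn (fun x => g1n n x / f1n n x) (Set.Ioi 0))
    -- (ii) the ratio g_{1:n}/f_{1:n} is decreasing in n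
    (hanti : ∀ x : ℝ, 0 < x → Antitone (fun n : ℕ+ => g1n n x / f1n n x))
    -- (iii) X_{1:n₁} ≥_lr X_{1:n₂} whenever n₁ ≤ n₂
    (hRR2 : ∀ n₁ n₂ : ℕ+, n₁ ≤ n₂ →
      MonotoneOn (fun x => f1n n₁ x / f1n n₂ x) (Set.Ioi 0))
    -- (iv) summability
    (hsumf : ∀ x : ℝ, 0 < x → Summable (fun n : ℕ+ => p n * f1n n x))
    (hsumg : ∀ x : ℝ, 0 < x → Summable (fun n : ℕ+ => p n * g1n n x)) :
    MonotoneOn (fun x => (∑' n : ℕ+, p n * g1n n x) / (∑' n : ℕ+, p n * f1n n x))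
      (Set.Ioi 0) := by
  have key : ∀ x y : ℝ, 0 < x → 0 < y → x ≤ y → ∀ m n : ℕ+, m ≤ n →
      g1n m x * f1n n y + g1n n x * f1n m y ≤ g1n m y * f1n n x + g1n n y * f1n m x := by
    intro x y hx hy hxy m n hmn
    have am := hfpos m x hx
    have an := hfpos n x hx
    have bm := hfpos m y hy
    have bn := hfpos n y hy
    have h1 := hlr m hx hy hxy
    have h2 := hlr n hx hy hxy
    have h3 := hanti x hx hmn
    have h4 := hRR2 m n hmn hx hy hxy
    simp only at h1 h2 h3 h4
    rw [div_le_div_iff₀ an bn] at h4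
    obtain ⟨rm, hrm⟩ : ∃ r, r = g1n m x / f1n m x := ⟨_, rfl⟩
    obtain ⟨rn, hrn⟩ : ∃ r, r = g1n n x / f1n n x := ⟨_, rfl⟩
    rw [← hrm] at h1 h3
    rw [← hrn] at h2 h3
    rw [le_div_iff₀ bm] at h1
    rw [le_div_iff₀ bn] at h2
    rw [eq_div_iff am.ne'] at hrm
    rw [eq_div_iff an.ne'] at hrn
    rw [← hrm, ← hrn]
    have e1 := mul_le_mul_of_nonneg_right h1 an.le
    have e2 := mul_le_mul_of_nonneg_right h2 am.le
    have e3 := mul_nonneg (sub_nonneg.2 h3) (sub_nonneg.2 h4)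
    linarith
  intro x hx y hy hxy
  have hx' : 0 < x := hx
  have hy' : 0 < y := hy
  have key2 : ∀ m n : ℕ+,
      g1n m x * f1n n y + g1n n x * f1n m y ≤ g1n m y * f1n n x + g1n n y * f1n m x := by
    intro m n
    rcases le_total m n with h | h
    · exact key x y hx' hy' hxy m n h
    · have := key x y hx' hy' hxy n m h
      linarith
  have hF : ∀ z : ℝ, 0 < z → 0 < ∑' n : ℕ+, p n * f1n n z := by
    intro z hz
    obtain ⟨n, hn⟩ : ∃ n, p n ≠ 0 := by
      by_contra! h
      have h0 : p = fun _ => 0 := funext h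
      rw [h0] at hp1
      exact zero_ne_one (hasSum_zero.unique hp1)
    exact (hsumf z hz).tsum_pos (fun i => mul_nonneg (hp i) (hfpos i z hz).le) n
      (mul_pos (lt_of_le_of_ne (hp n) hn.symm) (hfpos n z hz))
  simp only
  rw [div_le_div_iff₀ (hF x hx') (hF y hy')]
  refine le_of_tendsto_of_tendsto' (Filter.Tendsto.mul (hsumg x hx').hasSum (hsumf y hy').hasSum)
    (Filter.Tendsto.mul (hsumg y hy').hasSum (hsumf x hx').hasSum) ?_
  intro s
  have hfin : ∀ u v : ℕ+ → ℝ, 2 * ((∑ i ∈ s, u i) * ∑ i ∈ s, v i)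
      = ∑ i ∈ s, ∑ j ∈ s, (u i * v j + u j * v i) := by
    intro u v
    simp only [Finset.sum_add_distrib]
    rw [Finset.sum_comm (f := fun i j => u j * v i), ← Finset.sum_mul_sum]
    ring
  have := hfin (fun n => p n * g1n n x) (fun n => p n * f1n n y)
  have h' := hfin (fun n => p n * g1n n y) (fun n => p n * f1n n x)
  have hle : ∑ i ∈ s, ∑ j ∈ s, (p i * g1n i x * (p j * f1n j y) + p j * g1n j x * (p i * f1n i y))
     ≤ ∑ i ∈ s, ∑ j ∈ s, (p i * g1n i y * (p j * f1n j x) + p j * g1n j y * (p i * f1n i x)) := by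
    refine Finset.sum_le_sum fun i _ => Finset.sum_le_sum fun j _ => ?_
    have := mul_le_mul_of_nonneg_left (key2 i j) (mul_nonneg (hp i) (hp j))
    linarith
  linarith
end

section
/- Let f_{n:n}, g_{n:n} : (0,∞) → (0,∞) (n ∈ ℕ+) be families of positive functions (the densities of maximum order statistics X_{n:n} and Y_{n:n}), and let p : ℕ+ → ℝ satisfy p(n) ≥ 0 for all n and ∑_{n=1}^∞ p(n) = 1 (a probability mass function). Assume: (i) for each n, the map x ↦ g_{n:n}(x)/f_{n:n}(x) is increasing on (0,∞) (i.e. X_{n:n} ≤_lr Y_{n:n} for every n); (ii) for each x, the map n ↦ g_{n:n}(x)/f_{n:n}(x) is increasing on ℕ+; (iii) for all n₁ ≤ n₂ in ℕ+, the map x ↦ f_{n₁:n₁}(x)/f_{n₂:n₂}(x) is decreasing on (0,∞) (i.e. X_{n₁:n₁} ≤_lr X_{n₂:n₂} whenever n₁ ≤ n₂); (iv) for each x, the series ∑_{n=1}^∞ p(n) f_{n:n}(x) and ∑_{n=1}^∞ p(n) g_{n:n}(x) converge. Then the map x ↦ (∑_{n=1}^∞ p(n) g_{n:n}(x)) / (∑_{n=1}^∞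 p(n) f_{n:n}(x)) is increasing on (0,∞), i.e. X_{N:N} ≤_lr Y_{N:N} where N has pmf p. -/
/-- Theorem 3.7: likelihood ratio ordering of random maxima. -/
theorem thm_3_7
    (fnn gnn : ℕ+ → ℝ → ℝ)
    (hfpos : ∀ (n : ℕ+) (x : ℝ), 0 < x → 0 < fnn n x)
    (hgpos : ∀ (n : ℕ+) (x : ℝ), 0 < x → 0 < gnn n x)
    (p : ℕ+ → ℝ) (hp : ∀ n, 0 ≤ p n) (hp1 : HasSum p 1)
    -- (i) X_{n:n} ≤_lr Y_{n:n} for every n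
    (hlr : ∀ n : ℕ+, MonotoneOn (fun x => gnn n x / fnn n x) (Set.Ioi 0))
    -- (ii) the ratio g_{n:n}/f_{n:n} is increasing in n
    (hmono : ∀ x : ℝ, 0 < x → Monotone (fun n : ℕ+ => gnn n x / fnn n x))
    -- (iii) X_{n₁:n₁} ≤_lr X_{n₂:n₂} whenever n₁ ≤ n₂
    (hTP2 : ∀ n₁ n₂ : ℕ+, n₁ ≤ n₂ →
      AntitoneOn (fun x => fnn n₁ x / fnn n₂ x) (Set.Ioi 0))
    -- (iv) summability
    (hsumf : ∀ x : ℝ, 0 < x → Summable (fun n : ℕ+ => p n * fnn n x))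
    (hsumg : ∀ x : ℝ, 0 < x → Summable (fun n : ℕ+ => p n * gnn n x)) :
    MonotoneOn (fun x => (∑' n : ℕ+, p n * gnn n x) / (∑' n : ℕ+, p n * fnn n x))
      (Set.Ioi 0) := by
  intro x hx y hy hxy
  have hx0 : 0 < x := hx
  have hy0 : 0 < y := hy
  have hFpos : ∀ z : ℝ, 0 < z → 0 < ∑' n : ℕ+, p n * fnn n z := by
    intro z hz
    have : ∃ n, p n ≠ 0 := by
      by_contra hcon
      push Not at hcon
      have h0 : p = fun _ => 0 := funext hcon
      rw [h0] at hp1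
      exact zero_ne_one (hasSum_zero.unique hp1)
    obtain ⟨n, hn⟩ := this
    exact (hsumf z hz).tsum_pos (fun m => mul_nonneg (hp m) (hfpos m z hz).le) n
      (mul_pos (lt_of_le_of_ne (hp n) (Ne.symm hn)) (hfpos n z hz))
  have core : ∀ n m : ℕ+, n ≤ m →
      0 ≤ gnn n y * fnn m x + gnn m y * fnn n x - gnn n x * fnn m y - gnn m x * fnn n y := by
    intro n m hnm
    have a1 := hfpos n x hx0
    have a2 := hfpos m x hx0
    have a3 := hfpos n y hy0
    have a4 := hfpos m y hy0
    have h1 := hlr n hx hy hxy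
    have h2 := hlr m hx hy hxy
    have h3 := hmono x hx0 hnm
    have h4 := hTP2 n m hnm hx hy hxy
    simp only at h1 h2 h3 h4
    rw [div_le_div_iff₀ a4 a2] at h4
    have e1 : gnn n x = gnn n x / fnn n x * fnn n x := by field_simp
    have e2 : gnn m x = gnn m x / fnn m x * fnn m x := by field_simp
    rw [le_div_iff₀ a3] at h1
    rw [le_div_iff₀ a4] at h2
    generalize gnn n x / fnn n x = r at *
    generalize gnn m x / fnn m x = t at *
    rw [e1, e2]
    have k1 := mul_le_mul_of_nonneg_right h1 a2.le
    have k2 := mul_le_mul_of_nonneg_right h2 a1.le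
    have k3 := mul_nonneg (sub_nonneg.2 h3) (sub_nonneg.2 h4)
    linarith
  have core' : ∀ n m : ℕ+,
      0 ≤ gnn n y * fnn m x + gnn m y * fnn n x - gnn n x * fnn m y - gnn m x * fnn n y := by
    intro n m
    rcases le_total n m with h | h
    · exact core n m h
    · have := core m n h
      linarith
  have fin : ∀ s : Finset ℕ+, (∑ n ∈ s, p n * gnn n x) * (∑ n ∈ s, p n * fnn n y) ≤
      (∑ n ∈ s, p n * gnn n y) * (∑ n ∈ s, p n * fnn n x) := by
    intro s
    rw [← sub_nonneg]
    have e : (∑ n ∈ s, p n * gnn n y) * (∑ n ∈ s, p n * fnn n x) -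
        (∑ n ∈ s, p n * gnn n x) * (∑ n ∈ s, p n * fnn n y) =
        ∑ n ∈ s, ∑ m ∈ s, (p n * gnn n y * (p m * fnn m x) - p n * gnn n x * (p m * fnn m y)) := by
      simp only [Finset.sum_mul_sum, Finset.sum_sub_distrib]
    have e' := e
    rw [Finset.sum_comm] at e'
    have h : 0 ≤ ∑ n ∈ s, ∑ m ∈ s,
        ((p n * gnn n y * (p m * fnn m x) - p n * gnn n x * (p m * fnn m y)) +
        (p m * gnn m y * (p n * fnn n x) - p m * gnn m x * (p n * fnn n y))) := by
      refine Finset.sum_nonneg fun n _ => Finset.sum_nonneg fun m _ => ?_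
      have := mul_nonneg (mul_nonneg (hp n) (hp m)) (core' n m)
      linarith
    simp only [Finset.sum_add_distrib] at h
    linarith
  have lim := le_of_tendsto_of_tendsto'
    (Filter.Tendsto.mul (hsumg x hx0).hasSum (hsumf y hy0).hasSum)
    (Filter.Tendsto.mul (hsumg y hy0).hasSum (hsumf x hx0).hasSum) fin
  simp only
  rw [div_le_div_iff₀ (hFpos x hx0) (hFpos y hy0)]
  exact lim
end

section
/- Let f_{n:n}, g_{n:n} : (0,∞) → (0,∞) (n ∈ ℕ+) be families of positive functions (the densities of maximum order statistics X_{n:n} and Y_{n:n}), and let p : ℕ+ → ℝ satisfy p(n) ≥ 0 for all n and ∑_{n=1}^∞ p(n) = 1 (a probability mass function). Assume: (i) for each n, the map x ↦ g_{n:n}(x)/f_{n:n}(x) is decreasing on (0,∞) (i.e. X_{n:n} ≥_lr Y_{n:n} for every n); (ii) for each x, the map n ↦ g_{n:n}(x)/f_{n:n}(x) is decreasing on ℕ+; (iii) for all n₁ ≤ n₂ in ℕ+, the map x ↦ f_{n₁:n₁}(x)/f_{n₂:n₂}(x) is decreasing on (0,∞) (i.e. X_{n₁:n₁} ≤_lr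 X_{n₂:n₂} whenever n₁ ≤ n₂); (iv) for each x, the series ∑_{n=1}^∞ p(n) f_{n:n}(x) and ∑_{n=1}^∞ p(n) g_{n:n}(x) converge. Then the map x ↦ (∑_{n=1}^∞ p(n) g_{n:n}(x)) / (∑_{n=1}^∞ p(n) f_{n:n}(x)) is decreasing on (0,∞), i.e. X_{N:N} ≥_lr Y_{N:N} where N has pmf p. -/
theorem aux_pair (a b c d a' b' c' d' : ℝ) (ha : 0 < a) (hb : 0 < b) (hc : 0 < c) (hd : 0 < d)
    (h1 : c' / c ≤ a' / a) (h2 : d' / d ≤ b' / b) (h3 : b' / b ≤ a' / a)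
    (h4 : c / d ≤ a / b) :
    c' * b + d' * a ≤ a' * d + b' * c := by
  obtain ⟨ra, rfl⟩ : ∃ r, a' = r * a := ⟨a' / a, by field_simp⟩
  obtain ⟨rb, rfl⟩ : ∃ r, b' = r * b := ⟨b' / b, by field_simp⟩
  obtain ⟨rc, rfl⟩ : ∃ r, c' = r * c := ⟨c' / c, by field_simp⟩
  obtain ⟨rd, rfl⟩ : ∃ r, d' = r * d := ⟨d' / d, by field_simp⟩
  rw [mul_div_cancel_right₀ _ ha.ne', mul_div_cancel_right₀ _ hc.ne'] at h1
  rw [mul_div_cancel_right₀ _ hd.ne', mul_div_cancel_right₀ _ hb.ne'] at h2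
  rw [mul_div_cancel_right₀ _ ha.ne', mul_div_cancel_right₀ _ hb.ne'] at h3
  rw [div_le_div_iff₀ hd hb] at h4
  have e1 := mul_le_mul_of_nonneg_right h1 (mul_pos hc hb).le
  have e2 := mul_le_mul_of_nonneg_right h2 (mul_pos hd ha).le
  nlinarith [mul_nonneg (sub_nonneg.2 h3) (sub_nonneg.2 h4)]

/-- Theorem 3.8: likelihood ratio ordering of random maxima. -/
theorem thm_3_8
    (fnn gnn : ℕ+ → ℝ → ℝ)
    (hfpos : ∀ (n : ℕ+) (x : ℝ), 0 < x → 0 < fnn n x)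
    (hgpos : ∀ (n : ℕ+) (x : ℝ), 0 < x → 0 < gnn n x)
    (p : ℕ+ → ℝ) (hp : ∀ n, 0 ≤ p n) (hp1 : HasSum p 1)
    -- (i) X_{n:n} ≥_lr Y_{n:n} for every n
    (hlr : ∀ n : ℕ+, AntitoneOn (fun x => gnn n x / fnn n x) (Set.Ioi 0))
    -- (ii) the ratio g_{n:n}/f_{n:n} is decreasing in n
    (hanti : ∀ x : ℝ, 0 < x → Antitone (fun n : ℕ+ => gnn n x / fnn n x))
    -- (iii) X_{n₁:n₁} ≤_lr X_{n₂:n₂} whenever n₁ ≤ n₂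
    (hTP2 : ∀ n₁ n₂ : ℕ+, n₁ ≤ n₂ →
      AntitoneOn (fun x => fnn n₁ x / fnn n₂ x) (Set.Ioi 0))
    -- (iv) summability
    (hsumf : ∀ x : ℝ, 0 < x → Summable (fun n : ℕ+ => p n * fnn n x))
    (hsumg : ∀ x : ℝ, 0 < x → Summable (fun n : ℕ+ => p n * gnn n x)) :
    AntitoneOn (fun x => (∑' n : ℕ+, p n * gnn n x) / (∑' n : ℕ+, p n * fnn n x))
      (Set.Ioi 0) := by
  intro x hx y hy hxy
  have hx0 : 0 < x := hx
  have hy0 : 0 < y := hy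
  have hpair : ∀ m n : ℕ+, gnn m y * fnn n x + gnn n y * fnn m x
      ≤ gnn m x * fnn n y + gnn n x * fnn m y := by
    have key : ∀ m n : ℕ+, m ≤ n → gnn m y * fnn n x + gnn n y * fnn m x
      ≤ gnn m x * fnn n y + gnn n x * fnn m y := fun m n hmn =>
      aux_pair (fnn m x) (fnn n x) (fnn m y) (fnn n y) _ _ _ _
        (hfpos m x hx0) (hfpos n x hx0) (hfpos m y hy0) (hfpos n y hy0)
        (hlr m hx hy hxy) (hlr n hx hy hxy) (hanti x hx0 hmn) (hTP2 m n hmn hx hy hxy)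
    intro m n
    rcases le_total m n with h | h
    · exact key m n h
    · linarith [key n m h]
  have hfin : ∀ s : Finset ℕ+,
      (∑ n ∈ s, p n * gnn n y) * (∑ n ∈ s, p n * fnn n x)
      ≤ (∑ n ∈ s, p n * gnn n x) * (∑ n ∈ s, p n * fnn n y) := by
    intro s
    have h : ∑ m ∈ s, ∑ n ∈ s, (p m * p n) * (gnn m y * fnn n x + gnn n y * fnn m x)
        ≤ ∑ m ∈ s, ∑ n ∈ s, (p m * p n) * (gnn m x * fnn n y + gnn n x * fnn m y) :=
      Finset.sum_le_sum fun m _ => Finset.sum_le_sum fun n _ =>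
        mul_le_mul_of_nonneg_left (hpair m n) (mul_nonneg (hp m) (hp n))
    have e : ∀ u v : ℝ, ∑ m ∈ s, ∑ n ∈ s, (p m * p n) * (gnn m u * fnn n v + gnn n u * fnn m v)
        = 2 * ((∑ n ∈ s, p n * gnn n u) * (∑ n ∈ s, p n * fnn n v)) := by
      intro u v
      rw [two_mul]
      nth_rewrite 2 [mul_comm]
      rw [Finset.sum_mul_sum, Finset.sum_mul_sum, ← Finset.sum_add_distrib]
      refine Finset.sum_congr rfl fun m _ => ?_
      rw [← Finset.sum_add_distrib]
      refine Finset.sum_congr rfl fun n _ => ?_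
      ring
    rw [e, e] at h
    linarith
  have hF : ∀ z : ℝ, 0 < z → 0 < ∑' n : ℕ+, p n * fnn n z := by
    intro z hz
    obtain ⟨k, hk⟩ : ∃ k, p k ≠ 0 := by
      by_contra! hcon
      have : p = fun _ => 0 := funext hcon
      rw [this] at hp1
      exact zero_ne_one (hasSum_zero.unique hp1)
    exact (hsumf z hz).tsum_pos (fun n => mul_nonneg (hp n) (hfpos n z hz).le) k
      (mul_pos (lt_of_le_of_ne (hp k) hk.symm) (hfpos k z hz))
  change _ / _ ≤ _ / _
  rw [div_le_div_iff₀ (hF y hy0) (hF x hx0)]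
  exact le_of_tendsto_of_tendsto'
    (Filter.Tendsto.mul (hsumg y hy0).hasSum (hsumf x hx0).hasSum)
    (Filter.Tendsto.mul (hsumg x hx0).hasSum (hsumf y hy0).hasSum) hfin
end
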